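/- For all t>0, θ∈ℝ, a>0, ℓ>0 lying in the bulk region |θ| ≤ at/2, writing R̃ = R̃(t,θ,a,ℓ) and p = p(a,ℓ): at ≲ R̃ ≲ p + at, and moreover |∂_θR̃ − 1| ≲ p/(at), |∂ₐR̃ − t| ≲ ⟨p/a⟩·ln⟨t⟩, |∂²_θR̃| ≲ p/(a²t²), |∂²_{θa}R̃| ≲ p/(a²t), and |∂²ₐR̃| ≲ (1/a)·⟨p/a⟩·ln⟨t⟩. -/

import Mathlib

noncomputable section

open Real MeasureTheory Set Filter

/-- Japanese bracket `⟨x⟩ := √(2+x²)`. -/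
def jb (x : ℝ) : ℝ := Real.sqrt (2 + x ^ 2)

/-- `κ(a,ℓ) := (1 + 4a²ℓ/m²)^{-1/2}`. -/
def kpa (m a ℓ : ℝ) : ℝ := 1 / Real.sqrt (1 + 4 * a ^ 2 * ℓ / m ^ 2)

/-- `p(a,ℓ) := m / (2a²κ(a,ℓ))`. -/
def pfn (m a ℓ : ℝ) : ℝ := m / (2 * a ^ 2 * kpa m a ℓ)

/-- `r₀(a,ℓ) := p(a,ℓ)(1-κ(a,ℓ))`. -/
def rZero (m a ℓ : ℝ) : ℝ := pfn m a ℓ * (1 - kpa m a ℓ)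

/-- `G_κ(y) := √(y²-1) - κ ln(y + √(y²-1))`. -/
def Gf (κ y : ℝ) : ℝ := Real.sqrt (y ^ 2 - 1) - κ * Real.log (y + Real.sqrt (y ^ 2 - 1))

/-- `H_κ : [0,∞) → [1,∞)`, the inverse of `G_κ` on `[1,∞)`. -/
def Hf (κ x : ℝ) : ℝ := Function.invFunOn (Gf κ) (Set.Ici 1) x

/-- Inverse hyperbolic cosine `arcosh x = ln (x + √(x²-1))`. -/
def acosh (x : ℝ) : ℝ := Real.log (x + Real.sqrt (x ^ 2 - 1))

/-- The radial function `R(θ,a,ℓ)`. -/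
def Rf (m θ a ℓ : ℝ) : ℝ :=
  pfn m a ℓ * Hf (kpa m a ℓ) (|θ| / pfn m a ℓ) - pfn m a ℓ * kpa m a ℓ

/-- The radial velocity `V(θ,a,ℓ)`. -/
def Vf (m θ a ℓ : ℝ) : ℝ :=
  Real.sign θ * a *
    Real.sqrt (1 + m / (a ^ 2 * Rf m θ a ℓ) - ℓ / (a ^ 2 * (Rf m θ a ℓ) ^ 2))

/-- The dynamical radial function `R̃(t,θ,a,ℓ) = R(θ+at,a,ℓ)`. -/
def Rtil (m t θ a ℓ : ℝ) : ℝ := Rf m (θ + a * t) a ℓ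

/-- The action `𝒜(r,v,ℓ) = √(v² - m/r + ℓ/r²)`. -/
def Acal (m r v ℓ : ℝ) : ℝ := Real.sqrt (v ^ 2 - m / r + ℓ / r ^ 2)

/-- The angle `Θ(r,v,ℓ) = sgn(v)·p(𝒜,ℓ)·G_{κ(𝒜,ℓ)}(r/p(𝒜,ℓ) + κ(𝒜,ℓ))`. -/
def Theta (m r v ℓ : ℝ) : ℝ :=
  Real.sign v * pfn m (Acal m r v ℓ) ℓ *
    Gf (kpa m (Acal m r v ℓ) ℓ) (r / pfn m (Acal m r v ℓ) ℓ + kpa m (Acal m r v ℓ) ℓ)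

/-- The phase space `ℝ×(0,∞)×(0,∞)` in the variables `(θ,a,ℓ)`. -/
def phaseSet : Set (ℝ × ℝ × ℝ) := Set.univ ×ˢ Set.Ioi 0 ×ˢ Set.Ioi 0

/-- The gravitational field
`F(t,r) = -(1/r²)·∫∫∫ 1_{R(θ+ta,a,ℓ) ≤ r} γ(θ,a,ℓ)² dθ da dℓ`. -/
def gravF (m : ℝ) (γ : ℝ × ℝ × ℝ → ℝ) (t r : ℝ) : ℝ :=
  -(1 / r ^ 2) *
    (∫⁻ x in {x : ℝ × ℝ × ℝ | Rf m (x.1 + t * x.2.1) x.2.1 x.2.2 ≤ r},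
        ENNReal.ofReal ((γ x) ^ 2) ∂(volume.restrict phaseSet)).toReal

/-- The effective gravitational field
`F_eff(t,r) = -(1/r²)·∫∫∫ 1_{at ≤ r} γ(θ,a,ℓ)² dθ da dℓ`. -/
def gravFeff (γ : ℝ × ℝ × ℝ → ℝ) (t r : ℝ) : ℝ :=
  -(1 / r ^ 2) *
    (∫⁻ x in {x : ℝ × ℝ × ℝ | x.2.1 * t ≤ r},
        ENNReal.ofReal ((γ x) ^ 2) ∂(volume.restrict phaseSet)).toReal


/-- The solution `u` of `sinh u - κ u = z`. -/
def Us (κ z : ℝ) : ℝ := Function.invFun (fun u : ℝ => Real.sinh u - κ * u) z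

lemma shk_strictMono {κ : ℝ} (h1 : κ < 1) : StrictMono (fun u : ℝ => Real.sinh u - κ * u) := by
  apply strictMono_of_deriv_pos
  intro u
  have h : HasDerivAt (fun u : ℝ => Real.sinh u - κ * u) (Real.cosh u - κ * 1) u :=
    (Real.hasDerivAt_sinh u).sub ((hasDerivAt_id u).const_mul κ)
  rw [h.deriv]
  have := Real.one_le_cosh u
  linarith

lemma shk_surj {κ : ℝ} (h1 : κ < 1) (z : ℝ) : ∃ u : ℝ, Real.sinh u - κ * u = z := by
  have hc : Continuous (fun u : ℝ => Real.sinh u - κ * u) := by fun_prop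
  have hu : 0 ≤ |z| / (1 - κ) := div_nonneg (abs_nonneg z) (by linarith)
  have he : (1 - κ) * (|z| / (1 - κ)) = |z| := by
    field_simp [show (1 - κ) ≠ 0 by linarith]
  have hs := Real.self_le_sinh_iff.2 hu
  apply mem_range_of_exists_le_of_exists_ge hc
  · refine ⟨-(|z| / (1 - κ)), ?_⟩
    have := neg_abs_le z
    simp only [Real.sinh_neg]
    nlinarith
  · refine ⟨|z| / (1 - κ), ?_⟩
    have := le_abs_self z
    show z ≤ Real.sinh (|z| / (1 - κ)) - κ * (|z| / (1 - κ))
    nlinarith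

lemma Us_spec {κ : ℝ} (h1 : κ < 1) (z : ℝ) : Real.sinh (Us κ z) - κ * Us κ z = z :=
  Function.invFun_eq (f := fun u : ℝ => Real.sinh u - κ * u) (shk_surj h1 z)

lemma Us_unique {κ : ℝ} (h1 : κ < 1) {u z : ℝ} (h : Real.sinh u - κ * u = z) : u = Us κ z := by
  apply (shk_strictMono h1).injective
  show Real.sinh u - κ * u = Real.sinh (Us κ z) - κ * Us κ z
  rw [h, Us_spec h1]

lemma Us_pos {κ : ℝ} (h1 : κ < 1) {z : ℝ} (hz : 0 < z) : 0 < Us κ z := by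
  by_contra hh
  push Not at hh
  have h2 := (shk_strictMono h1).monotone hh
  simp only [Us_spec h1] at h2
  simp at h2
  linarith

lemma Us_hasDerivAt {κ : ℝ} (h1 : κ < 1) (z : ℝ) :
    HasFDerivAt (fun x : ℝ × ℝ => Us x.1 x.2)
      ((Us κ z / (Real.cosh (Us κ z) - κ)) • ContinuousLinearMap.fst ℝ ℝ ℝ
        + (1 / (Real.cosh (Us κ z) - κ)) • ContinuousLinearMap.snd ℝ ℝ ℝ) (κ, z) := by
  set u := Us κ z with hu
  have hspec : Real.sinh u - κ * u = z := Us_spec h1 z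
  have hρ : 0 < Real.cosh u - κ := by have := Real.one_le_cosh u; linarith
  let e : (ℝ × ℝ) ≃L[ℝ] (ℝ × ℝ) := ContinuousLinearEquiv.equivOfInverse
    ((ContinuousLinearMap.fst ℝ ℝ ℝ).prod
      ((-u) • ContinuousLinearMap.fst ℝ ℝ ℝ
        + (Real.cosh u - κ) • ContinuousLinearMap.snd ℝ ℝ ℝ))
    ((ContinuousLinearMap.fst ℝ ℝ ℝ).prod
      ((u / (Real.cosh u - κ)) • ContinuousLinearMap.fst ℝ ℝ ℝ
        + (1 / (Real.cosh u - κ)) • ContinuousLinearMap.snd ℝ ℝ ℝ))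
    (by
      intro x
      ext
      · simp
      · simp; field_simp; ring)
    (by
      intro x
      ext
      · simp
      · simp; field_simp; ring)
  have hf : HasStrictFDerivAt (fun x : ℝ × ℝ => (x.1, Real.sinh x.2 - x.1 * x.2))
      (e : (ℝ × ℝ) →L[ℝ] (ℝ × ℝ)) (κ, u) := by
    have hfst : HasStrictFDerivAt (fun x : ℝ × ℝ => x.1) (ContinuousLinearMap.fst ℝ ℝ ℝ) (κ, u) :=
      hasStrictFDerivAt_fst
    have hsnd : HasStrictFDerivAt (fun x : ℝ × ℝ => x.2) (ContinuousLinearMap.snd ℝ ℝ ℝ) (κ, u) :=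
      hasStrictFDerivAt_snd
    have h2 := hfst.prodMk (hsnd.sinh.sub (hfst.mul hsnd))
    refine h2.congr_fderiv ?_
    ext <;> simp [e]
  have hg := hf.to_localInverse.hasFDerivAt
  have hr := hf.eventually_right_inverse
  simp only [hspec] at hg hr
  have hg2 := hg.snd
  have hlt : ∀ᶠ y : ℝ × ℝ in nhds (κ, z), y.1 < 1 :=
    (continuous_fst.tendsto (κ, z)).eventually (gt_mem_nhds h1)
  have hee : (fun x : ℝ × ℝ => Us x.1 x.2) =ᶠ[nhds (κ, z)]
      fun y => (hf.localInverse _ _ _ y).2 := by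
    filter_upwards [hr, hlt] with y hy hy1
    symm
    have ha := congrArg Prod.fst hy
    have hb := congrArg Prod.snd hy
    simp only at ha hb
    apply Us_unique hy1
    rw [← hb, ha]
  have hg3 := hg2.congr_of_eventuallyEq hee
  refine hg3.congr_fderiv ?_
  ext <;> simp [e]

lemma Us_curve {κ z : ℝ → ℝ} {κ' z' a : ℝ} (h1 : κ a < 1) (hk : HasDerivAt κ κ' a)
    (hz : HasDerivAt z z' a) :
    HasDerivAt (fun b => Us (κ b) (z b))
      ((z' + κ' * Us (κ a) (z a)) / (Real.cosh (Us (κ a) (z a)) - κ a)) a := by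
  have h := (Us_hasDerivAt h1 (z a))
  have hc : HasDerivAt (fun b => (κ b, z b)) (κ', z') a := hk.prodMk hz
  have h2 := HasFDerivAt.comp_hasDerivAt (f := fun b => (κ b, z b)) a h hc
  refine h2.congr_deriv ?_
  simp
  ring

lemma Hf_eq {κ z : ℝ} (h1 : κ < 1) (hz : 0 < z) : Hf κ z = Real.cosh (Us κ z) := by
  have key : ∀ v : ℝ, 0 ≤ v → Gf κ (Real.cosh v) = Real.sinh v - κ * v := by
    intro v hv
    have hs : Real.sqrt (Real.cosh v ^ 2 - 1) = Real.sinh v := by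
      rw [show Real.cosh v ^ 2 - 1 = Real.sinh v ^ 2 by rw [Real.cosh_sq]; ring,
        Real.sqrt_sq (Real.sinh_nonneg_iff.2 hv)]
    unfold Gf
    rw [hs, Real.cosh_add_sinh, Real.log_exp]
  have hex : ∃ y ∈ Set.Ici (1 : ℝ), Gf κ y = z :=
    ⟨Real.cosh (Us κ z), Real.one_le_cosh _, by rw [key _ (Us_pos h1 hz).le, Us_spec h1]⟩
  have hmem : Hf κ z ∈ Set.Ici (1 : ℝ) := Function.invFunOn_mem hex
  have heq : Gf κ (Hf κ z) = z := Function.invFunOn_eq hex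
  have hmem' : 1 ≤ Hf κ z := hmem
  rw [← Real.cosh_arcosh hmem'] at heq
  rw [key _ (Real.arcosh_nonneg hmem')] at heq
  rw [← Us_unique h1 heq, Real.cosh_arcosh hmem']

lemma kpa_pos (m a ℓ : ℝ) (hl : 0 < ℓ) : 0 < kpa m a ℓ := by
  unfold kpa
  have : 0 ≤ 4 * a ^ 2 * ℓ / m ^ 2 := by positivity
  positivity

lemma kpa_lt_one {m a ℓ : ℝ} (hm : 0 < m) (ha : 0 < a) (hl : 0 < ℓ) : kpa m a ℓ < 1 := by
  unfold kpa
  have h : 0 < 4 * a ^ 2 * ℓ / m ^ 2 := by positivity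
  have h2 : 1 < Real.sqrt (1 + 4 * a ^ 2 * ℓ / m ^ 2) := by
    rw [Real.lt_sqrt (by norm_num)]
    linarith
  rw [div_lt_one (by linarith)]
  exact h2

lemma pfn_pos {m a ℓ : ℝ} (hm : 0 < m) (ha : 0 < a) (hl : 0 < ℓ) : 0 < pfn m a ℓ := by
  unfold pfn
  have := kpa_pos m a ℓ hl
  positivity

lemma kpa_hasDerivAt {m a ℓ : ℝ} (hm : 0 < m) (ha : 0 < a) (hl : 0 < ℓ) :
    HasDerivAt (fun b => kpa m b ℓ) (-(kpa m a ℓ * (1 - kpa m a ℓ ^ 2) / a)) a := by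
  have hpos : 0 < 1 + 4 * a ^ 2 * ℓ / m ^ 2 := by positivity
  have hi : HasDerivAt (fun b : ℝ => 1 + 4 * b ^ 2 * ℓ / m ^ 2) (8 * a * ℓ / m ^ 2) a := by
    have h := ((((hasDerivAt_pow 2 a).const_mul 4).mul_const ℓ).div_const (m ^ 2)).const_add 1
    refine h.congr_deriv ?_
    simp
    ring
  have hs := (hi.sqrt hpos.ne').inv (Real.sqrt_pos.2 hpos).ne'
  have hk : (fun b => kpa m b ℓ) = fun b => (Real.sqrt (1 + 4 * b ^ 2 * ℓ / m ^ 2))⁻¹ := by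
    funext b
    simp [kpa]
  rw [hk]
  refine hs.congr_deriv ?_
  unfold kpa
  have hsq : Real.sqrt (1 + 4 * a ^ 2 * ℓ / m ^ 2) ^ 2 = 1 + 4 * a ^ 2 * ℓ / m ^ 2 :=
    Real.sq_sqrt hpos.le
  have hsp := Real.sqrt_pos.2 hpos
  set S := Real.sqrt (1 + 4 * a ^ 2 * ℓ / m ^ 2) with hS
  have h3 : 8 * a * ℓ / m ^ 2 = 2 * (S ^ 2 - 1) / a := by
    rw [hsq]
    field_simp
    ring
  rw [h3]
  field_simp
  try ring

lemma pfn_hasDerivAt {m a ℓ : ℝ} (hm : 0 < m) (ha : 0 < a) (hl : 0 < ℓ) :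
    HasDerivAt (fun b => pfn m b ℓ) (-((1 + kpa m a ℓ ^ 2) * pfn m a ℓ / a)) a := by
  have hk := kpa_hasDerivAt hm ha hl
  have hk0 := kpa_pos m a ℓ hl
  have h1 : HasDerivAt (fun b : ℝ => 2 * b ^ 2) (2 * (2 * a)) a := by
    have h := (hasDerivAt_pow 2 a).const_mul 2
    refine h.congr_deriv ?_
    simp
  have h2 := (hasDerivAt_const a m).div (h1.mul hk) (by simp; constructor <;> positivity)
  unfold pfn
  refine h2.congr_deriv ?_
  simp only [Pi.mul_apply]
  field_simp
  ring

lemma Rtil_eq {m t θ a ℓ : ℝ} (hm : 0 < m) (ha : 0 < a) (hl : 0 < ℓ) (hx : 0 < θ + a * t) :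
    Rtil m t θ a ℓ = pfn m a ℓ *
      (Real.cosh (Us (kpa m a ℓ) ((θ + a * t) / pfn m a ℓ)) - kpa m a ℓ) := by
  unfold Rtil Rf
  rw [abs_of_pos hx, Hf_eq (kpa_lt_one hm ha hl) (div_pos hx (pfn_pos hm ha hl))]
  ring

/-- The parameter `u` along the flow. -/
def uu (m t θ a ℓ : ℝ) : ℝ := Us (kpa m a ℓ) ((θ + a * t) / pfn m a ℓ)

lemma rho_pos {m a ℓ : ℝ} (hm : 0 < m) (ha : 0 < a) (hl : 0 < ℓ) (u : ℝ) :
    0 < Real.cosh u - kpa m a ℓ := by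
  have := Real.one_le_cosh u
  have := kpa_lt_one hm ha hl
  linarith

lemma uu_theta {m t θ a ℓ : ℝ} (hm : 0 < m) (ha : 0 < a) (hl : 0 < ℓ) :
    HasDerivAt (fun x => uu m t x a ℓ)
      (1 / (pfn m a ℓ * (Real.cosh (uu m t θ a ℓ) - kpa m a ℓ))) θ := by
  have hz : HasDerivAt (fun x => (x + a * t) / pfn m a ℓ) (1 / pfn m a ℓ) θ :=
    ((hasDerivAt_id θ).add_const (a * t)).div_const _
  have h := Us_curve (κ := fun _ => kpa m a ℓ) (kpa_lt_one hm ha hl) (hasDerivAt_const θ (kpa m a ℓ)) hz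
  refine h.congr_deriv ?_
  have := rho_pos hm ha hl (uu m t θ a ℓ)
  have := pfn_pos hm ha hl
  unfold uu at *
  field_simp
  ring

lemma uu_a {m t θ a ℓ : ℝ} (hm : 0 < m) (ha : 0 < a) (hl : 0 < ℓ) :
    HasDerivAt (fun x => uu m t θ x ℓ)
      ((t / pfn m a ℓ + ((1 + kpa m a ℓ ^ 2) * Real.sinh (uu m t θ a ℓ)
        - 2 * kpa m a ℓ * uu m t θ a ℓ) / a) / (Real.cosh (uu m t θ a ℓ) - kpa m a ℓ)) a := by
  have hp := pfn_pos hm ha hl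
  have hx : HasDerivAt (fun x => θ + x * t) t a := by
    have h := ((hasDerivAt_id a).mul_const t).const_add θ
    refine h.congr_deriv ?_
    simp
  have hz := hx.div (pfn_hasDerivAt hm ha hl) hp.ne'
  have h := Us_curve (κ := fun b => kpa m b ℓ) (kpa_lt_one hm ha hl) (kpa_hasDerivAt hm ha hl) hz
  refine h.congr_deriv ?_
  have hspec := Us_spec (kpa_lt_one hm ha hl) ((θ + a * t) / pfn m a ℓ)
  have hu : uu m t θ a ℓ = Us (kpa m a ℓ) (((fun x => θ + x * t) / fun b => pfn m b ℓ) a) := rfl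
  rw [← hu]
  have hu2 : uu m t θ a ℓ = Us (kpa m a ℓ) ((θ + a * t) / pfn m a ℓ) := rfl
  rw [← hu2] at hspec
  congr 1
  have hxx : θ + a * t = pfn m a ℓ * (Real.sinh (uu m t θ a ℓ) - kpa m a ℓ * uu m t θ a ℓ) := by
    rw [hspec]; field_simp
  rw [hxx]
  field_simp
  ring

lemma Rtil_theta {m t θ a ℓ : ℝ} (hm : 0 < m) (ha : 0 < a) (hl : 0 < ℓ) (hx : 0 < θ + a * t) :
    deriv (fun x => Rtil m t x a ℓ) θ =
      Real.sinh (uu m t θ a ℓ) / (Real.cosh (uu m t θ a ℓ) - kpa m a ℓ) := by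
  have hee : (fun x => Rtil m t x a ℓ) =ᶠ[nhds θ]
      fun x => pfn m a ℓ * (Real.cosh (uu m t x a ℓ) - kpa m a ℓ) := by
    have : ∀ᶠ x in nhds θ, 0 < x + a * t :=
      (((continuous_id.add continuous_const).tendsto θ)).eventually (lt_mem_nhds hx)
    filter_upwards [this] with x hx
    exact Rtil_eq hm ha hl hx
  rw [hee.deriv_eq]
  have h := (((uu_theta (t := t) (θ := θ) hm ha hl).cosh.sub_const (kpa m a ℓ)).const_mul
    (pfn m a ℓ))
  rw [h.deriv]
  have := rho_pos hm ha hl (uu m t θ a ℓ)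
  have := pfn_pos hm ha hl
  field_simp

lemma Rtil_theta2 {m t θ a ℓ : ℝ} (hm : 0 < m) (ha : 0 < a) (hl : 0 < ℓ) (hx : 0 < θ + a * t) :
    deriv (fun y => deriv (fun x => Rtil m t x a ℓ) y) θ =
      (1 - kpa m a ℓ * Real.cosh (uu m t θ a ℓ)) /
        (pfn m a ℓ * (Real.cosh (uu m t θ a ℓ) - kpa m a ℓ) ^ 3) := by
  have hee : (fun y => deriv (fun x => Rtil m t x a ℓ) y) =ᶠ[nhds θ]
      fun x => Real.sinh (uu m t x a ℓ) / (Real.cosh (uu m t x a ℓ) - kpa m a ℓ) := by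
    have : ∀ᶠ x in nhds θ, 0 < x + a * t :=
      (((continuous_id.add continuous_const).tendsto θ)).eventually (lt_mem_nhds hx)
    filter_upwards [this] with x hx
    exact Rtil_theta hm ha hl hx
  rw [hee.deriv_eq]
  have hu := uu_theta (t := t) (θ := θ) hm ha hl
  have hr := rho_pos hm ha hl (uu m t θ a ℓ)
  have h := hu.sinh.fun_div (hu.cosh.sub_const (kpa m a ℓ)) hr.ne'
  rw [h.deriv]
  have := pfn_pos hm ha hl
  have hc := Real.cosh_sq (uu m t θ a ℓ)
  field_simp
  linear_combination hc

lemma W_a {m t θ a ℓ : ℝ} (hm : 0 < m) (ha : 0 < a) (hl : 0 < ℓ) {v : ℝ}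
    (hu : HasDerivAt (fun x => uu m t θ x ℓ) v a) :
    HasDerivAt (fun x => Real.sinh (uu m t θ x ℓ) / (Real.cosh (uu m t θ x ℓ) - kpa m x ℓ))
      ((1 - kpa m a ℓ * Real.cosh (uu m t θ a ℓ)) * v /
          (Real.cosh (uu m t θ a ℓ) - kpa m a ℓ) ^ 2
        - Real.sinh (uu m t θ a ℓ) * (kpa m a ℓ * (1 - kpa m a ℓ ^ 2)) /
          (a * (Real.cosh (uu m t θ a ℓ) - kpa m a ℓ) ^ 2)) a := by
  have hr := rho_pos hm ha hl (uu m t θ a ℓ)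
  have h := hu.sinh.fun_div (hu.cosh.fun_sub (kpa_hasDerivAt hm ha hl)) hr.ne'
  refine h.congr_deriv ?_
  have hc := Real.cosh_sq (uu m t θ a ℓ)
  field_simp
  linear_combination (a * v) * hc

lemma E_a {m t θ a ℓ : ℝ} (hm : 0 < m) (ha : 0 < a) (hl : 0 < ℓ) {v : ℝ}
    (hu : HasDerivAt (fun x => uu m t θ x ℓ) v a) :
    HasDerivAt (fun x => (1 - kpa m x ℓ * Real.cosh (uu m t θ x ℓ)) /
        (Real.cosh (uu m t θ x ℓ) - kpa m x ℓ))
      (Real.sinh (uu m t θ a ℓ) ^ 2 * (kpa m a ℓ * (1 - kpa m a ℓ ^ 2)) /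
          (a * (Real.cosh (uu m t θ a ℓ) - kpa m a ℓ) ^ 2)
        - Real.sinh (uu m t θ a ℓ) * (1 - kpa m a ℓ ^ 2) * v /
          (Real.cosh (uu m t θ a ℓ) - kpa m a ℓ) ^ 2) a := by
  have hr := rho_pos hm ha hl (uu m t θ a ℓ)
  have hk := kpa_hasDerivAt hm ha hl
  have h := ((hk.fun_mul hu.cosh).const_sub 1).fun_div (hu.cosh.fun_sub hk) hr.ne'
  refine h.congr_deriv ?_
  have hc := Real.cosh_sq (uu m t θ a ℓ)
  field_simp
  linear_combination (kpa m a ℓ * (1 - kpa m a ℓ ^ 2)) * hc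

lemma Rtil_a {m t θ a ℓ : ℝ} (hm : 0 < m) (ha : 0 < a) (hl : 0 < ℓ) (hx : 0 < θ + a * t) :
    deriv (fun x => Rtil m t θ x ℓ) a =
      t * (Real.sinh (uu m t θ a ℓ) / (Real.cosh (uu m t θ a ℓ) - kpa m a ℓ))
      - pfn m a ℓ / a * ((1 + kpa m a ℓ ^ 2) * ((1 - kpa m a ℓ * Real.cosh (uu m t θ a ℓ)) /
        (Real.cosh (uu m t θ a ℓ) - kpa m a ℓ)) + 2 * kpa m a ℓ *
        (Real.sinh (uu m t θ a ℓ) / (Real.cosh (uu m t θ a ℓ) - kpa m a ℓ) * uu m t θ a ℓ - 1)) := by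
  have hee : (fun x => Rtil m t θ x ℓ) =ᶠ[nhds a]
      fun x => pfn m x ℓ * (Real.cosh (uu m t θ x ℓ) - kpa m x ℓ) := by
    have h1 : ∀ᶠ x in nhds a, 0 < θ + x * t :=
      ((show Continuous (fun x : ℝ => θ + x * t) by fun_prop).tendsto a).eventually (lt_mem_nhds hx)
    filter_upwards [h1, lt_mem_nhds ha] with x hx ha
    exact Rtil_eq hm ha hl hx
  rw [hee.deriv_eq]
  have h := (pfn_hasDerivAt hm ha hl).fun_mul
    ((uu_a (t := t) (θ := θ) hm ha hl).cosh.fun_sub (kpa_hasDerivAt hm ha hl))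
  rw [h.deriv]
  have hr := rho_pos hm ha hl (uu m t θ a ℓ)
  have hp := pfn_pos hm ha hl
  have hc := Real.cosh_sq (uu m t θ a ℓ)
  field_simp
  linear_combination (-pfn m a ℓ * (1 + kpa m a ℓ ^ 2)) * hc

lemma Rtil_theta_a {m t θ a ℓ : ℝ} (hm : 0 < m) (ha : 0 < a) (hl : 0 < ℓ) (hx : 0 < θ + a * t)
    {v : ℝ} (hu : HasDerivAt (fun x => uu m t θ x ℓ) v a) :
    deriv (fun a' => deriv (fun x => Rtil m t x a' ℓ) θ) a =
      ((1 - kpa m a ℓ * Real.cosh (uu m t θ a ℓ)) * v /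
          (Real.cosh (uu m t θ a ℓ) - kpa m a ℓ) ^ 2
        - Real.sinh (uu m t θ a ℓ) * (kpa m a ℓ * (1 - kpa m a ℓ ^ 2)) /
          (a * (Real.cosh (uu m t θ a ℓ) - kpa m a ℓ) ^ 2)) := by
  rw [← (W_a hm ha hl hu).deriv]
  apply Filter.EventuallyEq.deriv_eq
  have h1 : ∀ᶠ x in nhds a, 0 < θ + x * t :=
    ((show Continuous (fun x : ℝ => θ + x * t) by fun_prop).tendsto a).eventually (lt_mem_nhds hx)
  filter_upwards [h1, lt_mem_nhds ha] with x hx ha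
  exact Rtil_theta hm ha hl hx

lemma Rtil_a_a {m t θ a ℓ : ℝ} (hm : 0 < m) (ha : 0 < a) (hl : 0 < ℓ) (hx : 0 < θ + a * t)
    {v w e W E k u p : ℝ} (hu : HasDerivAt (fun x => uu m t θ x ℓ) v a)
    (hw : HasDerivAt (fun x => Real.sinh (uu m t θ x ℓ) /
      (Real.cosh (uu m t θ x ℓ) - kpa m x ℓ)) w a)
    (he : HasDerivAt (fun x => (1 - kpa m x ℓ * Real.cosh (uu m t θ x ℓ)) /
        (Real.cosh (uu m t θ x ℓ) - kpa m x ℓ)) e a)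
    (hk : k = kpa m a ℓ) (hp : p = pfn m a ℓ) (huu : u = uu m t θ a ℓ)
    (hW : W = Real.sinh u / (Real.cosh u - k)) (hE : E = (1 - k * Real.cosh u) /
      (Real.cosh u - k)) :
    deriv (fun a' => deriv (fun x => Rtil m t θ x ℓ) a') a =
      t * w + (2 + k ^ 2) * (p / a ^ 2) * ((1 + k ^ 2) * E + 2 * k * (W * u - 1))
      - p / a * (-2 * k * (k * (1 - k ^ 2) / a) * E + (1 + k ^ 2) * e
        - 2 * (k * (1 - k ^ 2) / a) * (W * u - 1) + 2 * k * (w * u + W * v)) := by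
  have hee : (fun a' => deriv (fun x => Rtil m t θ x ℓ) a') =ᶠ[nhds a] fun a =>
      t * (Real.sinh (uu m t θ a ℓ) / (Real.cosh (uu m t θ a ℓ) - kpa m a ℓ))
      - pfn m a ℓ / a * ((1 + kpa m a ℓ ^ 2) * ((1 - kpa m a ℓ * Real.cosh (uu m t θ a ℓ)) /
        (Real.cosh (uu m t θ a ℓ) - kpa m a ℓ)) + 2 * kpa m a ℓ *
        (Real.sinh (uu m t θ a ℓ) / (Real.cosh (uu m t θ a ℓ) - kpa m a ℓ) * uu m t θ a ℓ - 1)) := by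
    have h1 : ∀ᶠ x in nhds a, 0 < θ + x * t :=
      ((show Continuous (fun x : ℝ => θ + x * t) by fun_prop).tendsto a).eventually (lt_mem_nhds hx)
    filter_upwards [h1, lt_mem_nhds ha] with x hx ha
    exact Rtil_a hm ha hl hx
  rw [hee.deriv_eq]
  have hkd := kpa_hasDerivAt hm ha hl
  have hpa := (pfn_hasDerivAt hm ha hl).fun_div (hasDerivAt_id' a) ha.ne'
  have h := (hw.const_mul t).fun_sub (hpa.fun_mul ((((hkd.fun_pow 2).const_add 1).fun_mul he).fun_add
    ((hkd.const_mul 2).fun_mul ((hw.fun_mul hu).sub_const 1))))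
  rw [h.deriv]
  rw [← hk, ← hp, ← huu, ← hW, ← hE]
  field_simp
  ring

lemma sinh_le_mul_cosh {u : ℝ} (hu : 0 ≤ u) : Real.sinh u ≤ u * Real.cosh u := by
  have hm : MonotoneOn (fun x : ℝ => x * Real.cosh x - Real.sinh x) (Set.Ici 0) := by
    apply monotoneOn_of_deriv_nonneg (convex_Ici 0)
    · fun_prop
    · fun_prop
    · intro x hx
      simp only [interior_Ici, Set.mem_Ioi] at hx
      have h : HasDerivAt (fun x : ℝ => x * Real.cosh x - Real.sinh x)
          (1 * Real.cosh x + x * Real.sinh x - Real.cosh x) x :=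
        ((hasDerivAt_id' x).fun_mul (Real.hasDerivAt_cosh x)).fun_sub (Real.hasDerivAt_sinh x)
      rw [h.deriv]
      have := Real.sinh_pos_iff.2 hx
      nlinarith
  have := hm (Set.mem_Ici.2 le_rfl) (Set.mem_Ici.2 hu) hu
  simp at this
  linarith

lemma mul_sinh_le {u : ℝ} (hu : 0 ≤ u) :
    u * Real.sinh u ≤ (2 + u) * (Real.cosh u - 1) := by
  have h1 := Real.add_one_le_exp u
  have he := Real.exp_pos u
  rw [Real.cosh_eq, Real.sinh_eq, Real.exp_neg]
  have key : 0 ≤ (Real.exp u - 1) * (Real.exp u - (1 + u)) / Real.exp u := by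
    apply div_nonneg _ he.le
    apply mul_nonneg <;> linarith
  have e2 : (Real.exp u - 1) * (Real.exp u - (1 + u)) / Real.exp u =
    (2 + u) * ((Real.exp u + (Real.exp u)⁻¹) / 2 - 1) -
      u * ((Real.exp u - (Real.exp u)⁻¹) / 2) := by
    field_simp
    ring
  linarith

/-- Elementary bounds in terms of `κ` and `u`. -/
lemma basic_bounds {k u c s : ℝ} (hk : 0 < k) (hk1 : k < 1) (hu : 0 < u)
    (hc : c = Real.cosh u) (hs : s = Real.sinh u) :
    1 ≤ c ∧ u ≤ s ∧ c ^ 2 = s ^ 2 + 1 ∧ |1 - k * c| ≤ c - k ∧ s - k * u ≤ c - k ∧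
    s * (s - k * u) ≤ 2 * (c - k) ^ 2 ∧
    0 ≤ (1 + k ^ 2) * s - 2 * k * u ∧
    s * ((1 + k ^ 2) * s - 2 * k * u) ≤ 5 * (c - k) ^ 2 ∧
    s ^ 2 * (1 - k ^ 2) ≤ 4 * (c - k) ^ 2 ∧ 1 - k ^ 2 ≤ 2 * (c - k) ∧
    |s - (c - k)| ≤ 1 ∧ s * u ≤ (2 + u) * (c - k) := by
  have hc1 : 1 ≤ c := by rw [hc]; exact Real.one_le_cosh u
  have hus : u ≤ s := by rw [hs]; exact Real.self_le_sinh_iff.2 hu.le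
  have hcs : c ^ 2 = s ^ 2 + 1 := by rw [hc, hs]; exact Real.cosh_sq u
  have hsu : s ≤ u * c := by rw [hs, hc]; exact sinh_le_mul_cosh hu.le
  have hms : u * s ≤ (2 + u) * (c - 1) := by rw [hs, hc]; exact mul_sinh_le hu.le
  have hexp : c - s = Real.exp (-u) := by rw [hs, hc]; exact Real.cosh_sub_sinh u
  have hexp1 : 1 - u ≤ c - s := by rw [hexp]; linarith [Real.add_one_le_exp (-u)]
  have hexp0 : 0 < c - s := by rw [hexp]; exact Real.exp_pos _
  have hexp2 : c - s ≤ 1 := by rw [hexp]; exact Real.exp_le_one_iff.2 (by linarith)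
  have hs0 : 0 < s := by linarith
  -- general form of the key estimate
  have key : ∀ q : ℝ, 0 ≤ q → q ≤ 1 → s * (s - q * u) ≤ 2 * (c - q) ^ 2 := by
    intro q hq0 hq1
    have h1 : c * (s * (s - q * u)) ≤ s ^ 2 * (c - q) := by
      have : q * s * s ≤ q * s * (u * c) := by gcongr
      nlinarith
    have h2 : s ^ 2 * (c - q) ≤ c * (2 * (c - q) ^ 2) := by
      have h3 : s ^ 2 ≤ 2 * c * (c - q) := by nlinarith
      have h4 : 0 ≤ c - q := by linarith
      nlinarith
    exact le_of_mul_le_mul_left (h1.trans h2) (by linarith)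
  have hρ1 : c - 1 ≤ c - k := by linarith
  have hρ2 : 1 - k ≤ c - k := by linarith
  have hρ3 : (1 - k) * c ≤ c - k := by nlinarith
  have hρ4 : (1 - k) * s ≤ c - k := by nlinarith
  have hρ0 : 0 < c - k := by linarith
  refine ⟨hc1, hus, hcs, ?_, ?_, key k hk.le hk1.le, ?_, ?_, ?_, ?_, ?_, ?_⟩
  · rw [abs_le]; constructor <;> nlinarith
  · rcases le_total u 1 with h | h <;> nlinarith
  · nlinarith [sq_nonneg (1 - k), mul_nonneg hk.le (sub_nonneg.2 hus)]
  · have h1 := key 1 zero_le_one le_rfl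
    have h2 : (c - 1) ^ 2 ≤ (c - k) ^ 2 := pow_le_pow_left₀ (by linarith) hρ1 2
    have h3 : ((1 - k) * s) ^ 2 ≤ (c - k) ^ 2 :=
      pow_le_pow_left₀ (mul_nonneg (by linarith) hs0.le) hρ4 2
    have h4 : 2 * k * (s * (s - 1 * u)) ≤ 2 * (s * (s - 1 * u)) := by
      have : 0 ≤ s * (s - 1 * u) := mul_nonneg hs0.le (by linarith)
      nlinarith
    nlinarith
  · have h5 : (1 - k) * c * (c - 1) ≤ (c - k) * (c - k) :=
      mul_le_mul hρ3 hρ1 (by linarith) hρ0.le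
    have h6 : (1 - k) * (c - 1) ≤ (c - k) * (c - k) :=
      mul_le_mul hρ2 hρ1 (by linarith) hρ0.le
    have h7 : s ^ 2 * (1 - k) ≤ 2 * (c - k) ^ 2 := by nlinarith
    have h8 : 0 ≤ s ^ 2 * (1 - k) := by
      have : 0 ≤ 1 - k := by linarith
      positivity
    nlinarith
  · nlinarith
  · rw [abs_le]; constructor <;> linarith
  · nlinarith

lemma exp_bound {k u T : ℝ} (hk1 : k < 1) (hu : 0 < u)
    (h : Real.sinh u - k * u ≤ 3 / 2 * T) : Real.exp u ≤ 6 * (1 + T) := by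
  have h1 : Real.exp (-u) ≤ 1 := Real.exp_le_one_iff.2 (by linarith)
  have h2 := Real.add_one_le_exp (u - 2 * Real.log 2)
  have h3 : Real.exp (u - 2 * Real.log 2) = Real.exp u / 4 := by
    rw [Real.exp_sub, two_mul, Real.exp_add, Real.exp_log (by norm_num)]
    norm_num
  have h4 := Real.log_two_lt_d9
  have h5 : k * u ≤ u := by nlinarith
  rw [Real.sinh_eq] at h
  rw [h3] at h2
  linarith

lemma jb_bound {A B σ t u : ℝ} (hA : 0 ≤ A) (hB : 0 ≤ B) (hσ : 0 < σ) (ht : 0 < t)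
    (hu : Real.exp u ≤ 6 * (1 + t / σ)) :
    σ * (A + B * u) ≤ (3 * A + 11 * B) * jb σ * Real.log (jb t) := by
  have hj0 : σ ≤ jb σ := by
    unfold jb
    apply Real.le_sqrt_of_sq_le
    linarith
  have hj1 : 1 ≤ jb σ := by
    unfold jb
    apply Real.le_sqrt_of_sq_le
    nlinarith
  have hL : Real.log (jb t) = Real.log (2 + t ^ 2) / 2 := by
    unfold jb
    rw [Real.log_sqrt (by positivity)]
  have hL1 : 1 / 3 ≤ Real.log (jb t) := by
    rw [hL]
    have : Real.log 2 ≤ Real.log (2 + t ^ 2) :=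
      Real.log_le_log (by norm_num) (by nlinarith)
    have := Real.log_two_gt_d9
    linarith
  have hL2 : Real.log (1 + t) ≤ 2 * Real.log (jb t) := by
    rw [hL]
    have : Real.log (1 + t) ≤ Real.log (2 + t ^ 2) :=
      Real.log_le_log (by positivity) (by nlinarith [sq_nonneg (t - 1)])
    linarith
  have hu1 : u ≤ 2 + Real.log (1 + t) + Real.log (1 + 1 / σ) := by
    have h1 : (6 : ℝ) * (1 + t / σ) ≤ Real.exp 2 * ((1 + t) * (1 + 1 / σ)) := by
      have he : (6 : ℝ) ≤ Real.exp 2 := by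
        have := Real.exp_one_gt_d9
        have h2 : Real.exp 2 = Real.exp 1 * Real.exp 1 := by rw [← Real.exp_add]; norm_num
        rw [h2]; nlinarith
      have h3 : 1 + t / σ ≤ (1 + t) * (1 + 1 / σ) := by
        have : 0 < 1 / σ := by positivity
        have : t / σ = t * (1 / σ) := by ring
        nlinarith
      gcongr
    have h2 := Real.log_le_log (Real.exp_pos u) (hu.trans h1)
    rw [Real.log_exp, Real.log_mul (Real.exp_pos 2).ne' (by positivity), Real.log_exp,
      Real.log_mul (by positivity) (by positivity)] at h2
    linarith
  have hs1 : σ * Real.log (1 + 1 / σ) ≤ 1 := by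
    have h1 := Real.log_le_sub_one_of_pos (show 0 < 1 + 1 / σ by positivity)
    have h2 : Real.log (1 + 1 / σ) ≤ 1 / σ := by linarith
    calc σ * Real.log (1 + 1 / σ) ≤ σ * (1 / σ) := by gcongr
      _ = 1 := by field_simp
  have hJL : jb σ ≤ 3 * (jb σ * Real.log (jb t)) := by nlinarith
  have hσL : σ * Real.log (1 + t) ≤ 2 * (jb σ * Real.log (jb t)) := by
    have h0 : 0 ≤ Real.log (1 + t) := Real.log_nonneg (by linarith)
    calc σ * Real.log (1 + t) ≤ jb σ * (2 * Real.log (jb t)) := by gcongr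
      _ = _ := by ring
  have hσu : σ * u ≤ 2 * σ + σ * Real.log (1 + t) + 1 := by nlinarith
  have hσu2 : σ * u ≤ 11 * (jb σ * Real.log (jb t)) := by linarith
  have hσA : σ ≤ 3 * (jb σ * Real.log (jb t)) := by linarith
  nlinarith [mul_le_mul_of_nonneg_left hσu2 hB, mul_le_mul_of_nonneg_left hσA hA]

lemma abs_div_le_of {x y B : ℝ} (hy : 0 < y) (h : |x| ≤ B * y) : |x / y| ≤ B := by
  rw [abs_div, abs_of_pos hy, div_le_iff₀ hy]
  exact h

/-- All scale-free bounds. Here `T = a t / p`. -/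
lemma scaled_bounds {k u c s T r J N : ℝ} (hk : 0 < k) (hk1 : k < 1) (hu : 0 < u)
    (hc : c = Real.cosh u) (hs : s = Real.sinh u) (hr : r = c - k)
    (hJ : J = (1 + k ^ 2) * s - 2 * k * u) (hT : 0 < T) (hT2 : T ≤ 2 * (s - k * u))
    (hN : N = (1 - k * c) * ((T + J) / r) / r ^ 2 - s * (k * (1 - k ^ 2)) / r ^ 2) :
    s * |N| ≤ 13 ∧ |s ^ 2 * (k * (1 - k ^ 2)) / r ^ 2 - s * (1 - k ^ 2) * ((T + J) / r) / r ^ 2| ≤ 22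
    ∧ |s / r * ((T + J) / r)| ≤ 9 ∧ |(1 - k * c) / r| ≤ 1 ∧ |s / r * u - 1| ≤ 1 + u
    ∧ T * |s / r - 1| ≤ 2 := by
  obtain ⟨hc1, hus, hcs, hE, hz, hsz, hJ0, hsJ, hsk, hk2, hd, hsu⟩ := basic_bounds hk hk1 hu hc hs
  rw [← hr] at hE hz hsz hsJ hsk hk2 hd hsu
  rw [← hJ] at hJ0 hsJ
  have hr0 : 0 < r := by rw [hr]; linarith
  have hs0 : 0 < s := by linarith
  have hsTJ : s * (T + J) ≤ 9 * r ^ 2 := by nlinarith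
  have hsTJ0 : 0 ≤ s * (T + J) := by positivity
  have hkk : 0 < 1 - k ^ 2 := by nlinarith
  have hskk : s ^ 2 * (k * (1 - k ^ 2)) ≤ 4 * r ^ 2 := by
    have : 0 ≤ s ^ 2 * (1 - k ^ 2) := by positivity
    nlinarith
  have hskk0 : 0 ≤ s ^ 2 * (k * (1 - k ^ 2)) := by positivity
  have h4 : |s ^ 2 * (k * (1 - k ^ 2)) / r ^ 2| ≤ 4 :=
    abs_div_le_of (by positivity) (by rw [abs_of_nonneg hskk0]; exact hskk)
  have h9 : |s * (T + J) / r ^ 2| ≤ 9 :=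
    abs_div_le_of (by positivity) (by rw [abs_of_nonneg hsTJ0]; exact hsTJ)
  have hE1 : |(1 - k * c) / r| ≤ 1 := abs_div_le_of hr0 (by linarith)
  refine ⟨?_, ?_, ?_, hE1, ?_, ?_⟩
  · have e : s * N = (1 - k * c) / r * (s * (T + J) / r ^ 2) - s ^ 2 * (k * (1 - k ^ 2)) / r ^ 2 := by
      rw [hN]; field_simp
    have e2 : s * |N| = |s * N| := by rw [abs_mul, abs_of_pos hs0]
    rw [e2, e]
    refine (abs_sub _ _).trans ?_
    rw [abs_mul]
    have : |(1 - k * c) / r| * |s * (T + J) / r ^ 2| ≤ 1 * 9 :=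
      mul_le_mul hE1 h9 (abs_nonneg _) zero_le_one
    linarith
  · have e : s * (1 - k ^ 2) * ((T + J) / r) / r ^ 2 = (1 - k ^ 2) / r * (s * (T + J) / r ^ 2) := by
      field_simp
    rw [e]
    refine (abs_sub _ _).trans ?_
    rw [abs_mul]
    have h2 : |(1 - k ^ 2) / r| ≤ 2 := abs_div_le_of hr0 (by rw [abs_of_pos hkk]; exact hk2)
    have : |(1 - k ^ 2) / r| * |s * (T + J) / r ^ 2| ≤ 2 * 9 :=
      mul_le_mul h2 h9 (abs_nonneg _) zero_le_two
    linarith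
  · have e : s / r * ((T + J) / r) = s * (T + J) / r ^ 2 := by field_simp
    rw [e]; exact h9
  · have e0 : 0 ≤ s / r * u := by positivity
    have e1 : s / r * u ≤ 2 + u := by
      have : s / r * u = s * u / r := by ring
      rw [this, div_le_iff₀ hr0]; exact hsu
    rw [abs_le]; constructor <;> linarith
  · have e : s / r - 1 = (s - r) / r := by field_simp
    rw [e, abs_div, abs_of_pos hr0, ← mul_div_assoc, div_le_iff₀ hr0]
    nlinarith [abs_nonneg (s - r)]

set_option maxHeartbeats 2000000 in
/-- estimates for `R̃` and its derivatives in the bulk `|θ| ≤ at/2`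
(constants depending only on `m`). -/
theorem statement12 (m : ℝ) (hm : 0 < m) :
    ∃ C : ℝ, 0 < C ∧ ∀ t θ a ℓ : ℝ, 0 < t → 0 < a → 0 < ℓ → |θ| ≤ a * t / 2 →
      (a * t ≤ C * Rtil m t θ a ℓ ∧ Rtil m t θ a ℓ ≤ C * (pfn m a ℓ + a * t)) ∧
      |deriv (fun θ' => Rtil m t θ' a ℓ) θ - 1| ≤ C * (pfn m a ℓ / (a * t)) ∧
      |deriv (fun a' => Rtil m t θ a' ℓ) a - t| ≤
        C * jb (pfn m a ℓ / a) * Real.log (jb t) ∧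
      |deriv (fun θ' => deriv (fun θ'' => Rtil m t θ'' a ℓ) θ') θ| ≤
        C * (pfn m a ℓ / (a ^ 2 * t ^ 2)) ∧
      |deriv (fun a' => deriv (fun θ' => Rtil m t θ' a' ℓ) θ) a| ≤
        C * (pfn m a ℓ / (a ^ 2 * t)) ∧
      |deriv (fun a' => deriv (fun a'' => Rtil m t θ a'' ℓ) a') a| ≤
        C * ((1 / a) * jb (pfn m a ℓ / a) * Real.log (jb t)) := by
  refine ⟨500, by norm_num, ?_⟩
  intro t θ a ℓ ht ha hl hθ
  have hat : 0 < a * t := mul_pos ha ht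
  have hθ' := abs_le.1 hθ
  have hx : 0 < θ + a * t := by linarith [hθ'.1]
  have hua := uu_a (t := t) (θ := θ) hm ha hl
  have hwa := W_a hm ha hl hua
  have hea := E_a hm ha hl hua
  have hR := Rtil_eq hm ha hl hx
  have hRt := Rtil_theta hm ha hl hx
  have hRa := Rtil_a hm ha hl hx
  have hRtt := Rtil_theta2 hm ha hl hx
  have hRta := Rtil_theta_a hm ha hl hx hua
  have hRaa := Rtil_a_a hm ha hl hx hua hwa hea rfl rfl rfl rfl rfl
  rw [hR, hRt, hRa, hRtt, hRta, hRaa]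
  change (a * t ≤ 500 * (pfn m a ℓ * (Real.cosh (uu m t θ a ℓ) - kpa m a ℓ)) ∧
    pfn m a ℓ * (Real.cosh (uu m t θ a ℓ) - kpa m a ℓ) ≤ _) ∧ _
  clear hR hRt hRa hRtt hRta hRaa hwa hea hua
  have hk := kpa_pos m a ℓ hl
  have hk1 := kpa_lt_one hm ha hl
  have hp := pfn_pos hm ha hl
  have hu : 0 < uu m t θ a ℓ := Us_pos hk1 (div_pos hx hp)
  have hz : Real.sinh (uu m t θ a ℓ) - kpa m a ℓ * uu m t θ a ℓ = (θ + a * t) / pfn m a ℓ :=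
    Us_spec hk1 _
  generalize uu m t θ a ℓ = u at *
  generalize kpa m a ℓ = k at *
  generalize pfn m a ℓ = p at *
  have hT : 0 < a * t / p := by positivity
  have hT2 : a * t / p ≤ 2 * (Real.sinh u - k * u) := by
    rw [hz, ← mul_div_assoc]
    rw [div_le_div_iff_of_pos_right hp]
    linarith [hθ'.1]
  have hT3 : Real.sinh u - k * u ≤ 3 / 2 * (a * t / p) := by
    rw [hz, ← mul_div_assoc]
    rw [div_le_div_iff_of_pos_right hp]
    linarith [hθ'.2]
  have hexp := exp_bound hk1 hu hT3
  obtain ⟨hc1, hus, hcs, hE, hzr, hsz, hJ0, hsJ, hsk, hk2, hd, hsu⟩ :=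
    basic_bounds hk hk1 hu rfl rfl
  obtain ⟨hN, hEd, hWv, hE1, hWu, hW1⟩ :=
    scaled_bounds hk hk1 hu rfl rfl rfl rfl hT hT2 rfl
  have hce : Real.cosh u ≤ Real.exp u := by
    rw [← Real.cosh_add_sinh]; linarith
  have hv : (t / p + ((1 + k ^ 2) * Real.sinh u - 2 * k * u) / a) / (Real.cosh u - k) =
      ((a * t / p + ((1 + k ^ 2) * Real.sinh u - 2 * k * u)) / (Real.cosh u - k)) / a := by
    have : Real.cosh u - k ≠ 0 := by linarith
    field_simp
  rw [hv]
  have hs0 : 0 < Real.sinh u := by linarith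
  generalize hcc : Real.cosh u = c at *
  generalize hss : Real.sinh u = s at *
  generalize hJJ : (1 + k ^ 2) * s - 2 * k * u = J at *
  have hr0 : 0 < c - k := by linarith
  generalize hrr : c - k = r at *
  have hNe : (1 - k * c) * ((a * t / p + J) / r / a) / r ^ 2 -
      s * (k * (1 - k ^ 2)) / (a * r ^ 2) = ((1 - k * c) * ((a * t / p + J) / r) / r ^ 2 -
      s * (k * (1 - k ^ 2)) / r ^ 2) / a := by
    field_simp
  have hEe : s ^ 2 * (k * (1 - k ^ 2)) / (a * r ^ 2) -
      s * (1 - k ^ 2) * ((a * t / p + J) / r / a) / r ^ 2 = (s ^ 2 * (k * (1 - k ^ 2)) / r ^ 2 -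
      s * (1 - k ^ 2) * ((a * t / p + J) / r) / r ^ 2) / a := by
    field_simp
  rw [hNe, hEe]
  generalize (1 - k * c) * ((a * t / p + J) / r) / r ^ 2 -
      s * (k * (1 - k ^ 2)) / r ^ 2 = N at *
  generalize s ^ 2 * (k * (1 - k ^ 2)) / r ^ 2 -
      s * (1 - k ^ 2) * ((a * t / p + J) / r) / r ^ 2 = Ed at *
  have hTN : a * t / p * |N| ≤ 26 := by
    have h1 : a * t / p ≤ 2 * s := by linarith [mul_pos hk hu]
    have h2 := mul_le_mul_of_nonneg_right h1 (abs_nonneg N)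
    linarith
  have hTp : a * t / p * p = a * t := by field_simp
  have hσ : 0 < p / a := by positivity
  have hexp' : Real.exp u ≤ 6 * (1 + t / (p / a)) := by
    have : t / (p / a) = a * t / p := by field_simp
    rw [this]; exact hexp
  have hTr : a * t / p ≤ 2 * r := by linarith
  have hWw : |s / r - 1| ≤ 500 * (p / (a * t)) := by
    have e : p / (a * t) = 1 / (a * t / p) := by field_simp
    rw [e, ← mul_div_assoc, le_div_iff₀ hT]
    linarith
  refine ⟨⟨?_, ?_⟩, hWw, ?_, ?_, ?_, ?_⟩
  · have h1 := mul_le_mul_of_nonneg_right hTr hp.le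
    have h2 := mul_pos hp hr0
    linarith
  · have h1 : r ≤ 6 * (1 + a * t / p) := by linarith
    have h2 : p * r ≤ p * (6 * (1 + a * t / p)) := by gcongr
    linarith
  · have h0 := jb_bound (A := 6) (B := 2) (by norm_num) (by norm_num) hσ ht hexp'
    have h1 : t * (s / r) - p / a * ((1 + k ^ 2) * ((1 - k * c) / r) + 2 * k * (s / r * u - 1)) - t
        = p / a * (a * t / p * (s / r - 1) -
          ((1 + k ^ 2) * ((1 - k * c) / r) + 2 * k * (s / r * u - 1))) := by
      field_simp
      ring
    rw [h1, abs_mul, abs_of_pos hσ]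
    have hb : |a * t / p * (s / r - 1) -
          ((1 + k ^ 2) * ((1 - k * c) / r) + 2 * k * (s / r * u - 1))| ≤ 6 + 2 * u := by
      have b1 : |a * t / p * (s / r - 1)| ≤ 2 := by rw [abs_mul, abs_of_pos hT]; exact hW1
      have b2 : |(1 + k ^ 2) * ((1 - k * c) / r)| ≤ 2 := by
        rw [abs_mul, abs_of_pos (by positivity : 0 < 1 + k ^ 2)]
        have hk2' : k ^ 2 < 1 := pow_lt_one₀ hk.le hk1 two_ne_zero
        have := mul_le_mul (by linarith : 1 + k ^ 2 ≤ 2) hE1 (abs_nonneg _) zero_le_two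
        linarith
      have b3 : |2 * k * (s / r * u - 1)| ≤ 2 * (1 + u) := by
        rw [abs_mul, abs_of_pos (by positivity : 0 < 2 * k)]
        exact mul_le_mul (by linarith : 2 * k ≤ 2) hWu (abs_nonneg _) zero_le_two
      rw [abs_le] at b1 b2 b3 ⊢
      constructor <;> linarith [b1.1, b1.2, b2.1, b2.2, b3.1, b3.2]
    have h2 : p / a * |a * t / p * (s / r - 1) -
          ((1 + k ^ 2) * ((1 - k * c) / r) + 2 * k * (s / r * u - 1))| ≤ p / a * (6 + 2 * u) := by
      gcongr
    have h3 : 0 ≤ p / a * (6 + 2 * u) := by positivity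
    linarith
  · have e : (1 - k * c) / (p * r ^ 3) = (1 - k * c) / r * (1 / (p * r ^ 2)) := by field_simp
    rw [e, abs_mul, abs_of_pos (by positivity : 0 < 1 / (p * r ^ 2))]
    have e2 : p / (a ^ 2 * t ^ 2) = 1 / (p * (a * t / p) ^ 2) := by field_simp
    rw [e2, ← mul_div_assoc (500 : ℝ), le_div_iff₀ (by positivity)]
    have e3 : |(1 - k * c) / r| * (1 / (p * r ^ 2)) * (p * (a * t / p) ^ 2) =
      |(1 - k * c) / r| * ((a * t / p) / r) ^ 2 := by
      field_simp
    rw [e3]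
    have h1 : a * t / p / r ≤ 2 := by rw [div_le_iff₀ hr0]; exact hTr
    have h2 : (a * t / p / r) ^ 2 ≤ 2 ^ 2 := pow_le_pow_left₀ (by positivity) h1 2
    have h3 := mul_le_mul hE1 h2 (by positivity) zero_le_one
    linarith
  · have e2 : p / (a ^ 2 * t) = 1 / (a * (a * t / p)) := by field_simp
    rw [abs_div, abs_of_pos ha, e2, ← mul_div_assoc, div_le_div_iff₀ ha (by positivity)]
    have h1 := mul_le_mul_of_nonneg_left hTN ha.le
    linarith
  · have h0 := jb_bound (A := 130) (B := 8) (by norm_num) (by norm_num) hσ ht hexp'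
    generalize hEE : (1 - k * c) / r = E at *
    generalize hWWe : s / r = W at *
    generalize hVV : (a * t / p + J) / r = V at *
    have h1 : t * (N / a) + (2 + k ^ 2) * (p / a ^ 2) * ((1 + k ^ 2) * E + 2 * k * (W * u - 1)) -
        p / a * (-2 * k * (k * (1 - k ^ 2) / a) * E + (1 + k ^ 2) * (Ed / a) -
          2 * (k * (1 - k ^ 2) / a) * (W * u - 1) + 2 * k * (N / a * u + W * (V / a))) =
        1 / a * (p / a * (a * t / p * N + (2 + k ^ 2) * ((1 + k ^ 2) * E + 2 * k * (W * u - 1)) -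
        (-2 * k * (k * (1 - k ^ 2)) * E + (1 + k ^ 2) * Ed -
          2 * (k * (1 - k ^ 2)) * (W * u - 1) + 2 * k * (N * u + W * V)))) := by
      field_simp
    rw [h1]
    have hb : |a * t / p * N + (2 + k ^ 2) * ((1 + k ^ 2) * E + 2 * k * (W * u - 1)) -
        (-2 * k * (k * (1 - k ^ 2)) * E + (1 + k ^ 2) * Ed -
          2 * (k * (1 - k ^ 2)) * (W * u - 1) + 2 * k * (N * u + W * V))| ≤ 130 + 8 * u := by
      have hk2' : k ^ 2 < 1 := pow_lt_one₀ hk.le hk1 two_ne_zero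
      have hkk : 0 < 1 - k ^ 2 := by linarith
      have hk3 : 0 ≤ k * (1 - k ^ 2) := by positivity
      have hk4 : k * (1 - k ^ 2) ≤ 1 :=
        mul_le_one₀ hk1.le hkk.le (by linarith [sq_nonneg k])
      have hk5 : 2 * k * (k * (1 - k ^ 2)) ≤ 2 := by
        have := mul_le_mul (by linarith : 2 * k ≤ 2) hk4 hk3 zero_le_two
        linarith
      have gen : ∀ x y X Y : ℝ, 0 ≤ x → x ≤ X → |y| ≤ Y → |x * y| ≤ X * Y := by
        intro x y X Y hx hX hY
        rw [abs_mul, abs_of_nonneg hx]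
        exact mul_le_mul hX hY (abs_nonneg _) (hx.trans hX)
      have b1 : |a * t / p * N| ≤ 26 := by rw [abs_mul, abs_of_pos hT]; exact hTN
      have b2 := gen (1 + k ^ 2) E 2 1 (by positivity) (by linarith) hE1
      have b3 := gen (2 * k) (W * u - 1) 2 (1 + u) (by positivity) (by linarith) hWu
      have b23 : |(1 + k ^ 2) * E + 2 * k * (W * u - 1)| ≤ 2 * 1 + 2 * (1 + u) :=
        (abs_add_le _ _).trans (add_le_add b2 b3)
      have b4 := gen (2 + k ^ 2) _ 3 _ (by positivity) (by linarith) b23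
      have b5 := gen (2 * k * (k * (1 - k ^ 2))) E 2 1 (by positivity) hk5 hE1
      have b6 := gen (1 + k ^ 2) Ed 2 22 (by positivity) (by linarith) hEd
      have b7 := gen (2 * (k * (1 - k ^ 2))) (W * u - 1) 2 (1 + u) (by positivity)
        (by linarith) hWu
      have b8 : |N * u| ≤ 13 := by
        rw [abs_mul, abs_of_pos hu]
        have := mul_le_mul_of_nonneg_left hus (abs_nonneg N)
        linarith
      have b9 := gen (2 * k) (N * u + W * V) 2 (13 + 9) (by positivity) (by linarith)
        ((abs_add_le _ _).trans (add_le_add b8 hWv))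
      rw [abs_le] at b1 b4 b5 b6 b7 b9 ⊢
      constructor <;> linarith [b1.1, b1.2, b4.1, b4.2, b5.1, b5.2, b6.1, b6.2, b7.1, b7.2,
        b9.1, b9.2]
    rw [abs_mul, abs_mul, abs_of_pos hσ, abs_of_pos (by positivity : 0 < 1 / a)]
    have h2 := mul_le_mul_of_nonneg_left hb hσ.le
    have h3 : 0 ≤ p / a * (130 + 8 * u) := by positivity
    have h4 := h2.trans h0
    have h5 : (3 * 130 + 11 * 8) * jb (p / a) * Real.log (jb t) ≤
        500 * (jb (p / a) * Real.log (jb t)) := by linarith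
    calc _ ≤ 1 / a * (500 * (jb (p / a) * Real.log (jb t))) := by
          apply mul_le_mul_of_nonneg_left (h4.trans h5) (by positivity)
      _ = _ := by ring
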